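/- The trigonometric coalgebra C_k is isomorphic as a coalgebra to the circulant coalgebra C_k^2 if and only if char k = 2 or -1 is a square in k. -/

import Mathlib

open TensorProduct

/-- basis vector `c` of the trigonometric coalgebra -/
def trigC (k : Type*) [Field k] : k × k := (1, 0)
/-- basis vector `s` of the trigonometric coalgebra -/
def trigS (k : Type*) [Field k] : k × k := (0, 1)

/-- comultiplication of the trigonometric coalgebra:
`Δ(c) = c⊗c - s⊗s`, `Δ(s) = s⊗c + c⊗s`. -/
noncomputable def trigComul (k : Type*) [Field k] :
    (k × k) →ₗ[k] (k × k) ⊗[k] (k × k) :=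
  (LinearMap.fst k k k).smulRight (trigC k ⊗ₜ trigC k - trigS k ⊗ₜ trigS k) +
  (LinearMap.snd k k k).smulRight (trigS k ⊗ₜ trigC k + trigC k ⊗ₜ trigS k)

/-- counit of the trigonometric coalgebra: `ε(c) = 1`, `ε(s) = 0`. -/
def trigCounit (k : Type*) [Field k] : (k × k) →ₗ[k] k := LinearMap.fst k k k


/-- basis vector `F_j` of the circulant coalgebra `C_k^p` (realized as
`ZMod p → k`). -/
def circF (k : Type*) [Field k] (p : ℕ) (j : ZMod p) : ZMod p → k :=
  Pi.single j 1

/-- comultiplication of the circulant coalgebra: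
`Δ(F_j) = Σ_{I+J = j mod p} F_I ⊗ F_J`. -/
noncomputable def circComul (k : Type*) [Field k] (p : ℕ) [NeZero p] :
    (ZMod p → k) →ₗ[k] (ZMod p → k) ⊗[k] (ZMod p → k) :=
  ∑ I : ZMod p, ∑ J : ZMod p,
    (LinearMap.proj (I + J) : (ZMod p → k) →ₗ[k] k).smulRight
      (circF k p I ⊗ₜ[k] circF k p J)

/-- counit of the circulant coalgebra: `ε(F_j) = δ_{0j}`. -/
def circCounit (k : Type*) [Field k] (p : ℕ) [NeZero p] :
    (ZMod p → k) →ₗ[k] k :=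
  LinearMap.proj 0


theorem sum_zmod_two {M : Type*} [AddCommMonoid M] (f : ZMod 2 → M) :
    ∑ i, f i = f 0 + f 1 := Fin.sum_univ_two f

theorem circComul_two (k : Type*) [Field k] (x : ZMod 2 → k) :
    circComul k 2 x =
      x 0 • (circF k 2 0 ⊗ₜ[k] circF k 2 0 + circF k 2 1 ⊗ₜ[k] circF k 2 1) +
      x 1 • (circF k 2 0 ⊗ₜ[k] circF k 2 1 + circF k 2 1 ⊗ₜ[k] circF k 2 0) := by
  have h11 : (1 + 1 : ZMod 2) = 0 := by decide
  simp only [circComul, sum_zmod_two, LinearMap.add_apply, LinearMap.smulRight_apply, LinearMap.proj_apply,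
    h11, add_zero, zero_add, smul_add]
  abel

/-- The isomorphism `c ↦ F_0`, `s ↦ i F_1`. -/
def trigEquiv (k : Type*) [Field k] (i : k) (hi : i ^ 2 = -1) : (k × k) ≃ₗ[k] (ZMod 2 → k) where
  toFun x := x.1 • circF k 2 0 + (i * x.2) • circF k 2 1
  invFun y := (y 0, - i * y 1)
  map_add' x y := by
    simp only [Prod.fst_add, Prod.snd_add, mul_add, add_smul]; abel
  map_smul' a x := by
    simp only [Prod.smul_fst, Prod.smul_snd, smul_add, smul_smul, smul_eq_mul, RingHom.id_apply]
    congr 2; ring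
  left_inv x := by
    ext
    · simp [circF]
    · simp [circF]; linear_combination (-x.2) * hi
  right_inv y := by
    funext j
    have hj : j = 0 ∨ j = 1 := by revert j; decide
    rcases hj with rfl | rfl
    · simp [circF]
    · simp [circF]; linear_combination (-y 1) * hi

/-- The isomorphism `C_k ≅ C_k^2` exists iff `char k = 2` or `-1` is a square. -/
theorem trig_iso_circulant_iff (k : Type*) [Field k] :
    (∃ e : (k × k) ≃ₗ[k] (ZMod 2 → k),
      (∀ x : k × k,
        TensorProduct.map e.toLinearMap e.toLinearMap (trigComul k x) =
          circComul k 2 (e x)) ∧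
      ∀ x : k × k, circCounit k 2 (e x) = trigCounit k x) ↔
    (ringChar k = 2 ∨ ∃ i : k, i ^ 2 = -1) := by
  constructor
  · rintro ⟨e, h, hε⟩
    have hs0 : e (trigS k) 0 = 0 := by simpa [circCounit, trigCounit, trigS] using hε (trigS k)
    have hc0 : e (trigC k) 0 = 1 := by simpa [circCounit, trigCounit, trigC] using hε (trigC k)
    have hb : e (trigS k) 1 ≠ 0 := by
      intro hb
      have : e (trigS k) = 0 := by
        funext j
        have hj : j = 0 ∨ j = 1 := by revert j; decide
        rcases hj with rfl | rfl
        · exact hs0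
        · exact hb
      rw [LinearEquiv.map_eq_zero_iff] at this
      simp [trigS] at this
    let φ : (ZMod 2 → k) ⊗[k] (ZMod 2 → k) →ₗ[k] k :=
      LinearMap.mul' k k ∘ₗ TensorProduct.map (LinearMap.proj 1) (LinearMap.proj 1)
    have hφ : ∀ x y, φ (x ⊗ₜ y) = x 1 * y 1 := fun x y => by simp [φ]
    have Tc : trigComul k (trigC k) = trigC k ⊗ₜ trigC k - trigS k ⊗ₜ trigS k := by
      simp [trigComul, trigC]
    have Ts : trigComul k (trigS k) = trigS k ⊗ₜ trigC k + trigC k ⊗ₜ trigS k := by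
      simp [trigComul, trigS]
    have h1 := congrArg φ (h (trigS k))
    have h2 := congrArg φ (h (trigC k))
    rw [Ts, circComul_two] at h1
    rw [Tc, circComul_two] at h2
    simp only [map_add, map_sub, map_smul, TensorProduct.map_tmul, hφ, LinearEquiv.coe_coe, hs0,
      hc0] at h1 h2
    simp [circF] at h1 h2
    have h3 : (2 : k) * e (trigC k) 1 = 0 := by
      apply mul_left_cancel₀ hb
      linear_combination h1
    rcases mul_eq_zero.mp h3 with h4 | h4
    · left
      have hd : ringChar k ∣ 2 := (ringChar.spec k 2).mp (by exact_mod_cast h4)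
      rcases (Nat.dvd_prime Nat.prime_two).mp hd with h5 | h5
      · exact absurd h5 CharP.ringChar_ne_one
      · exact h5
    · right
      refine ⟨e (trigS k) 1, ?_⟩
      rw [h4] at h2
      linear_combination -h2
  · intro h
    have : ∃ i : k, i ^ 2 = -1 := by
      rcases h with h | h
      · have : CharP k 2 := ringChar.of_eq h
        exact ⟨1, by rw [CharTwo.neg_eq]; simp⟩
      · exact h
    obtain ⟨i, hi⟩ := this
    have ec : trigEquiv k i hi (trigC k) = circF k 2 0 := by simp [trigEquiv, trigC]
    have es : trigEquiv k i hi (trigS k) = i • circF k 2 1 := by simp [trigEquiv, trigS]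
    refine ⟨trigEquiv k i hi, fun x => ?_, fun x => ?_⟩
    · have x0 : trigEquiv k i hi x 0 = x.1 := by simp [trigEquiv, circF]
      have x1 : trigEquiv k i hi x 1 = i * x.2 := by simp [trigEquiv, circF]
      rw [circComul_two, x0, x1]
      simp only [trigComul, LinearMap.add_apply, LinearMap.smulRight_apply, LinearMap.fst_apply,
        LinearMap.snd_apply, map_add, map_sub, map_smul, TensorProduct.map_tmul,
        LinearEquiv.coe_coe, ec, es, TensorProduct.smul_tmul', TensorProduct.tmul_smul, smul_smul]
      have hii : i * i = -1 := by rw [← hi]; ring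
      simp only [← TensorProduct.smul_tmul', hii]
      module
    · simp [trigEquiv, circCounit, trigCounit, circF]
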